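/- arXiv:1109.1913 — 5 statements merged into one kernel-verified Lean document; each statement's English description precedes it below -/
import Mathlib

section
/- Let r > 0 and Δ ≥ 0 be reals such that |S_{r,Δ}((0,0),(−1,0))| = 4. Then there exists an (r,Δ)-identifying code C ⊆ ℤ² with D(C) = 3/8. -/
open Filter

def ball (r : ℝ) (u : ℤ × ℤ) : Set (ℤ × ℤ) :=
  {v : ℤ × ℤ | ((v.1 - u.1 : ℤ) : ℝ) ^ 2 + ((v.2 - u.2 : ℤ) : ℝ) ^ 2 ≤ r ^ 2}

def Spat (r Δ : ℝ) (u v : ℤ × ℤ) : Set (ℤ × ℤ) :=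
  (ball r u \ ball (r + Δ) v) ∪ (ball r v \ ball (r + Δ) u)

def IsIdCode (r Δ : ℝ) (C : Set (ℤ × ℤ)) : Prop :=
  (∀ u : ℤ × ℤ, (ball r u ∩ C).Nonempty) ∧
    ∀ u v : ℤ × ℤ, u ≠ v → (Spat r Δ u v ∩ C).Nonempty

def Qset (n : ℕ) : Set (ℤ × ℤ) := {p : ℤ × ℤ | |p.1| ≤ (n : ℤ) ∧ |p.2| ≤ (n : ℤ)}

noncomputable def density (C : Set (ℤ × ℤ)) : ℝ :=
  Filter.limsup
    (fun n : ℕ => (Nat.card ↥(C ∩ Qset n) : ℝ) / ((2 * (n : ℝ) + 1) ^ 2))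
    Filter.atTop

def IntersectsDiagMod (U : Set (ℤ × ℤ)) (k : ℕ) : Prop :=
  ∀ i : ℤ, ∃ p ∈ U, Int.ModEq (k : ℤ) (p.2 - p.1) i

def IntersectsAntiDiagMod (U : Set (ℤ × ℤ)) (k : ℕ) : Prop :=
  ∀ i : ℤ, ∃ p ∈ U, Int.ModEq (k : ℤ) (p.1 + p.2) i

def IntersectsHorizMod (U : Set (ℤ × ℤ)) (k : ℕ) : Prop :=
  ∀ i : ℤ, ∃ p ∈ U, Int.ModEq (k : ℤ) p.2 i

noncomputable def diagNum (U : Set (ℤ × ℤ)) : ℕ :=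
  sSup {k : ℕ | 0 < k ∧ IntersectsDiagMod U k}

def Lv (k : ℕ) : Set (ℤ × ℤ) := {p : ℤ × ℤ | (k : ℤ) ∣ p.1}
def Lh (k : ℕ) : Set (ℤ × ℤ) := {p : ℤ × ℤ | (k : ℤ) ∣ p.2}
def Ld (k : ℕ) : Set (ℤ × ℤ) := {p : ℤ × ℤ | (k : ℤ) ∣ (p.2 - p.1)}

/-- All odd-odd points, together with the even-even points lying in the odd cells of the
checkerboard with square cells of side `w`. -/
def checkerCode (w : ℤ) : Set (ℤ × ℤ) :=
  {p | (Odd p.1 ∧ Odd p.2) ∨ (Even p.1 ∧ Even p.2 ∧ (Odd (p.1 / w) ↔ Even (p.2 / w)))}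

/-- `p` lies within squared distance `m` of one of `u`, `v` and at squared distance at least `M`
from the other. -/
def Separates (m M : ℤ) (u v p : ℤ × ℤ) : Prop :=
  ((p.1 - u.1) ^ 2 + (p.2 - u.2) ^ 2 ≤ m ∧ M ≤ (p.1 - v.1) ^ 2 + (p.2 - v.2) ^ 2) ∨
    ((p.1 - v.1) ^ 2 + (p.2 - v.2) ^ 2 ≤ m ∧ M ≤ (p.1 - u.1) ^ 2 + (p.2 - u.2) ^ 2)

lemma mem_ball_iff {r : ℝ} {u p : ℤ × ℤ} :
    p ∈ ball r u ↔ (((p.1 - u.1) ^ 2 + (p.2 - u.2) ^ 2 : ℤ) : ℝ) ≤ r ^ 2 := by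
  simp [ball]

lemma Separates.symm {m M : ℤ} {u v p : ℤ × ℤ} (h : Separates m M u v p) :
    Separates m M v u p := Or.symm h

lemma Separates.mem_Spat {r Δ : ℝ} {m M : ℤ} {u v p : ℤ × ℤ} (hm : (m : ℝ) ≤ r ^ 2)
    (hM : (r + Δ) ^ 2 < M) (h : Separates m M u v p) : p ∈ Spat r Δ u v := by
  rcases h with ⟨h1, h2⟩ | ⟨h1, h2⟩
  · refine Or.inl ⟨mem_ball_iff.2 ((Int.cast_le.2 h1).trans hm), fun hc => ?_⟩
    exact absurd ((Int.cast_le.2 h2).trans (mem_ball_iff.1 hc)) hM.not_ge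
  · refine Or.inr ⟨mem_ball_iff.2 ((Int.cast_le.2 h1).trans hm), fun hc => ?_⟩
    exact absurd ((Int.cast_le.2 h2).trans (mem_ball_iff.1 hc)) hM.not_ge

lemma checkerCode_swap {w x y : ℤ} (h : (x, y) ∈ checkerCode w) : (y, x) ∈ checkerCode w := by
  simp only [checkerCode, Set.mem_ofPred_eq, ← Int.not_even_iff_odd] at h ⊢
  tauto

lemma sq_add_sq_le {a b x y : ℤ} (hx : |x| ≤ a) (hy : |y| ≤ b) :
    x ^ 2 + y ^ 2 ≤ a ^ 2 + b ^ 2 :=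
  add_le_add (sq_le_sq.2 (hx.trans (le_abs_self a))) (sq_le_sq.2 (hy.trans (le_abs_self b)))

lemma sq_add_sq_ge {a b x y : ℤ} (ha : 0 ≤ a) (hb : 0 ≤ b) (hx : a ≤ |x|) (hy : b ≤ |y|) :
    a ^ 2 + b ^ 2 ≤ x ^ 2 + y ^ 2 :=
  add_le_add (sq_le_sq.2 ((abs_of_nonneg ha).le.trans hx))
    (sq_le_sq.2 ((abs_of_nonneg hb).le.trans hy))

lemma checkerCode_vertical_pair {w b m x y : ℤ} (hw : 0 < w) (hb : 2 * b = w * m) (hm : Odd m)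
    (hxy : Even (x + (y + b))) :
    (x, y + b) ∈ checkerCode w ∨ (x, y - b) ∈ checkerCode w := by
  have hdiv : (y + b) / w = (y - b) / w + m := by
    rw [show y + b = y - b + w * m by lia, Int.add_mul_ediv_left _ _ hw.ne']
  simp only [checkerCode, Set.mem_ofPred_eq, hdiv]
  grind

lemma exists_separates_vertical {w a b m u1 v1 y : ℤ} (ha : 1 ≤ a) (hb1 : 1 ≤ b) (hw : 0 < w)
    (hb : 2 * b = w * m) (hm : Odd m) (huv : v1 < u1) :
    ∃ x z, (x, z) ∈ checkerCode w ∧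
      Separates (a ^ 2 + b ^ 2) ((a + 1) ^ 2 + b ^ 2) (u1, y) (v1, y) (x, z) := by
  obtain ⟨x, hpar, hx⟩ : ∃ x, Even (x + (y + b)) ∧
      (|x - u1| ≤ a ∧ a + 1 ≤ |x - v1| ∨ |x - v1| ≤ a ∧ a + 1 ≤ |x - u1|) := by
    by_cases h : Even (u1 + a + (y + b))
    · exact ⟨u1 + a, h, by grind⟩
    · by_cases h2 : v1 + 1 = u1
      · exact ⟨v1 - a, by grind, by grind⟩
      · exact ⟨u1 + a - 1, by grind, by grind⟩
  have key : ∀ z, |z - y| = b → Separates (a ^ 2 + b ^ 2) ((a + 1) ^ 2 + b ^ 2)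
      (u1, y) (v1, y) (x, z) := by
    intro z hz
    rcases hx with ⟨h1, h2⟩ | ⟨h1, h2⟩
    · exact Or.inl ⟨sq_add_sq_le h1 hz.le, sq_add_sq_ge (by lia) (by lia) h2 hz.ge⟩
    · exact Or.inr ⟨sq_add_sq_le h1 hz.le, sq_add_sq_ge (by lia) (by lia) h2 hz.ge⟩
  rcases checkerCode_vertical_pair hw hb hm hpar with h | h
  · exact ⟨x, y + b, h, key _ (by grind)⟩
  · exact ⟨x, y - b, h, key _ (by grind)⟩

lemma exists_odd_separates {a b u1 u2 v1 v2 : ℤ} (ha : 1 ≤ a) (hb : 1 ≤ b) (h1 : v1 < u1)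
    (h2 : v2 ≠ u2) :
    ∃ x y, Odd x ∧ Odd y ∧
      Separates (a ^ 2 + b ^ 2) ((a + 1) ^ 2 + b ^ 2) (u1, u2) (v1, v2) (x, y) := by
  have near : ∀ s t : ℤ, t ≠ s → ∃ y, Odd y ∧ |y - s| ≤ b ∧ b ≤ |y - t| := by
    intro s t hst
    rcases lt_or_gt_of_ne hst with h | h
    · by_cases hp : Odd (s + b)
      · exact ⟨s + b, hp, by grind⟩
      · exact ⟨s + b - 1, by grind, by grind⟩
    · by_cases hp : Odd (s - b)
      · exact ⟨s - b, hp, by grind⟩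
      · exact ⟨s - b + 1, by grind, by grind⟩
  obtain ⟨x, hodd, hx⟩ : ∃ x, Odd x ∧
      (|x - u1| ≤ a ∧ a + 1 ≤ |x - v1| ∨ |x - v1| ≤ a ∧ a + 1 ≤ |x - u1|) := by
    by_cases h : Odd (u1 + a)
    · exact ⟨u1 + a, h, by grind⟩
    · by_cases h2 : v1 + 1 = u1
      · exact ⟨v1 - a, by grind, by grind⟩
      · exact ⟨u1 + a - 1, by grind, by grind⟩
  rcases hx with ⟨hx1, hx2⟩ | ⟨hx1, hx2⟩
  · obtain ⟨y, hy, hy1, hy2⟩ := near u2 v2 h2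
    exact ⟨x, y, hodd, hy, Or.inl ⟨sq_add_sq_le hx1 hy1,
      sq_add_sq_ge (by lia) (by lia) hx2 hy2⟩⟩
  · obtain ⟨y, hy, hy1, hy2⟩ := near v2 u2 h2.symm
    exact ⟨x, y, hodd, hy, Or.inr ⟨sq_add_sq_le hx1 hy1,
      sq_add_sq_ge (by lia) (by lia) hx2 hy2⟩⟩

lemma exists_checkerCode_separates {w a b m : ℤ} (ha : 1 ≤ a) (hb1 : 1 ≤ b) (hw : 0 < w)
    (hb : 2 * b = w * m) (hm : Odd m) {u v : ℤ × ℤ} (huv : u ≠ v) :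
    ∃ p ∈ checkerCode w, Separates (a ^ 2 + b ^ 2) ((a + 1) ^ 2 + b ^ 2) u v p := by
  have left : ∀ {u v : ℤ × ℤ}, v.1 < u.1 →
      ∃ p ∈ checkerCode w, Separates (a ^ 2 + b ^ 2) ((a + 1) ^ 2 + b ^ 2) u v p := by
    rintro ⟨u1, u2⟩ ⟨v1, v2⟩ h
    by_cases h2 : v2 = u2
    · subst h2
      obtain ⟨x, z, hC, hS⟩ := exists_separates_vertical (y := v2) ha hb1 hw hb hm h
      exact ⟨_, hC, hS⟩
    · obtain ⟨x, y, hx, hy, hS⟩ := exists_odd_separates ha hb1 h h2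
      exact ⟨_, Or.inl ⟨hx, hy⟩, hS⟩
  have below : ∀ {u v : ℤ × ℤ}, v.1 = u.1 → v.2 < u.2 →
      ∃ p ∈ checkerCode w, Separates (a ^ 2 + b ^ 2) ((a + 1) ^ 2 + b ^ 2) u v p := by
    rintro ⟨u1, u2⟩ ⟨v1, v2⟩ h h2
    obtain rfl : v1 = u1 := h
    obtain ⟨x, z, hC, hS⟩ := exists_separates_vertical (y := v1) ha hb1 hw hb hm h2
    refine ⟨_, checkerCode_swap hC, ?_⟩
    simp only [Separates] at hS ⊢
    lia
  rcases lt_trichotomy v.1 u.1 with h | h | h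
  · exact left h
  · rcases lt_trichotomy v.2 u.2 with h2 | h2 | h2
    · exact below h h2
    · exact absurd (Prod.ext h.symm h2.symm) huv
    · obtain ⟨p, hp, hS⟩ := below h.symm h2
      exact ⟨p, hp, hS.symm⟩
  · obtain ⟨p, hp, hS⟩ := left h
    exact ⟨p, hp, hS.symm⟩

lemma exists_odd_mem_ball {r : ℝ} (hr : 2 ≤ r ^ 2) (u : ℤ × ℤ) :
    ∃ p ∈ ball r u, Odd p.1 ∧ Odd p.2 := by
  have near : ∀ s : ℤ, ∃ x, Odd x ∧ |x - s| ≤ 1 := by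
    intro s
    by_cases h : Odd s
    · exact ⟨s, h, by simp⟩
    · exact ⟨s + 1, by grind, by simp⟩
  obtain ⟨x, hx, hx1⟩ := near u.1
  obtain ⟨y, hy, hy1⟩ := near u.2
  refine ⟨(x, y), mem_ball_iff.2 (le_trans ?_ hr), hx, hy⟩
  have := sq_add_sq_le hx1 hy1
  exact_mod_cast this

/-- The number of elements of `[-n, n]` satisfying `P`. -/
noncomputable def countIcc (P : ℤ → Prop) [DecidablePred P] (n : ℕ) : ℕ :=
  ((Finset.Icc (-(n : ℤ)) n).filter P).card

lemma countIcc_le_of_shift {P Q : ℤ → Prop} [DecidablePred P] [DecidablePred Q] {k : ℕ}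
    (h : ∀ x, P x → Q (x - k)) (n : ℕ) : countIcc P n ≤ countIcc Q n + k := by
  have hsub : ((Finset.Icc (-(n : ℤ)) n).filter P).image (fun x => x - (k : ℤ)) ⊆
      (Finset.Icc (-(n : ℤ)) n).filter Q ∪ Finset.Ico (-(n : ℤ) - k) (-n) := by
    intro z hz
    simp only [Finset.mem_image, Finset.mem_filter, Finset.mem_Icc] at hz
    obtain ⟨x, ⟨hx, hP⟩, rfl⟩ := hz
    have := h x hP
    simp only [Finset.mem_union, Finset.mem_filter, Finset.mem_Icc, Finset.mem_Ico, this,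
      and_true]
    lia
  have hcard := (Finset.card_le_card hsub).trans (Finset.card_union_le _ _)
  rw [Finset.card_image_of_injective _ (sub_left_injective), Int.card_Ico] at hcard
  have : (-(n : ℤ) - (-(n : ℤ) - k)).toNat = k := by lia
  rwa [this] at hcard

lemma tendsto_div_of_bounded_error {f : ℕ → ℕ} {c K : ℝ}
    (h : ∀ n : ℕ, |(f n : ℝ) - c * (2 * (n : ℝ) + 1)| ≤ K) :
    Tendsto (fun n : ℕ => (f n : ℝ) / (2 * (n : ℝ) + 1)) atTop (nhds c) := by
  have hlin : Tendsto (fun n : ℕ => 2 * (n : ℝ) + 1) atTop atTop :=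
    tendsto_atTop_add_const_right _ _ (tendsto_natCast_atTop_atTop.const_mul_atTop two_pos)
  have hK : Tendsto (fun n : ℕ => K / (2 * (n : ℝ) + 1)) atTop (nhds 0) :=
    hlin.const_div_atTop K
  rw [tendsto_iff_dist_tendsto_zero]
  refine squeeze_zero (fun _ => dist_nonneg) (fun n => ?_) hK
  have hpos : (0 : ℝ) < 2 * (n : ℝ) + 1 := by positivity
  rw [Real.dist_eq, show (f n : ℝ) / (2 * (n : ℝ) + 1) - c
    = ((f n : ℝ) - c * (2 * (n : ℝ) + 1)) / (2 * (n : ℝ) + 1) by field_simp, abs_div,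
    abs_of_pos hpos]
  gcongr
  exact h n

lemma card_checkerCode_inter_Qset (w : ℤ) (n : ℕ) :
    Nat.card ↥(checkerCode w ∩ Qset n) = countIcc Odd n * countIcc Odd n +
      2 * (countIcc (fun x => Even x ∧ Even (x / w)) n *
        countIcc (fun x => Even x ∧ Odd (x / w)) n) := by
  set I := Finset.Icc (-(n : ℤ)) n with hI
  set O := I.filter Odd with hO
  set E₀ := I.filter (fun x => Even x ∧ Even (x / w)) with hE₀
  set E₁ := I.filter (fun x => Even x ∧ Odd (x / w)) with hE₁
  have hset : checkerCode w ∩ Qset n = ↑(O ×ˢ O ∪ (E₀ ×ˢ E₁ ∪ E₁ ×ˢ E₀)) := by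
    ext ⟨x, y⟩
    simp only [checkerCode, Qset, Set.mem_inter_iff, Set.mem_ofPred_eq, Finset.mem_coe,
      Finset.mem_union, Finset.mem_product, hO, hE₀, hE₁, hI, Finset.mem_filter, Finset.mem_Icc,
      abs_le, ← Int.not_even_iff_odd]
    tauto
  have hd₁ : Disjoint (E₀ ×ˢ E₁) (E₁ ×ˢ E₀) := by
    refine Finset.disjoint_left.2 fun p hp hq => ?_
    simp only [Finset.mem_product, hE₀, hE₁, Finset.mem_filter, ← Int.not_even_iff_odd] at hp hq
    tauto
  have hd₂ : Disjoint (O ×ˢ O) (E₀ ×ˢ E₁ ∪ E₁ ×ˢ E₀) := by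
    refine Finset.disjoint_left.2 fun p hp hq => ?_
    simp only [Finset.mem_union, Finset.mem_product, hO, hE₀, hE₁, Finset.mem_filter,
      ← Int.not_even_iff_odd] at hp hq
    tauto
  rw [hset, Nat.card_coe_set_eq, Set.ncard_coe_finset, Finset.card_union_of_disjoint hd₂,
    Finset.card_union_of_disjoint hd₁]
  simp only [Finset.card_product, countIcc, hO, hE₀, hE₁, hI]
  ring

lemma density_checkerCode {w : ℕ} (hw : 0 < w) (heven : Even w) :
    density (checkerCode w) = 3 / 8 := by
  have hw' : (w : ℤ) ≠ 0 := by lia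
  have heven' : Even (w : ℤ) := by exact_mod_cast heven
  have hdiv : ∀ x : ℤ, (x - w) / (w : ℤ) = x / w - 1 := fun x => by
    have := Int.add_mul_ediv_left x (-1) hw'
    rw [show x - (w : ℤ) = x + w * (-1) by ring, this]; ring
  set o := countIcc Odd
  set e₀ := countIcc (fun x : ℤ => Even x ∧ Even (x / (w : ℤ)))
  set e₁ := countIcc (fun x : ℤ => Even x ∧ Odd (x / (w : ℤ)))
  set e := countIcc (fun x : ℤ => Even x)
  have hoe : ∀ n, o n ≤ e n + 1 :=
    countIcc_le_of_shift fun x hx => by push_cast; grind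
  have heo : ∀ n, e n ≤ o n + 1 :=
    countIcc_le_of_shift fun x hx => by push_cast; grind
  have h01 : ∀ n, e₀ n ≤ e₁ n + w :=
    countIcc_le_of_shift fun x hx => by rw [hdiv]; grind
  have h10 : ∀ n, e₁ n ≤ e₀ n + w :=
    countIcc_le_of_shift fun x hx => by rw [hdiv]; grind
  have hsum : ∀ n, o n + e n = 2 * n + 1 := by
    intro n
    have := Finset.card_filter_add_card_filter_not (s := Finset.Icc (-(n : ℤ)) n) Odd
    simp only [Int.not_odd_iff_even, Int.card_Icc] at this
    simp only [o, e, countIcc]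
    lia
  have hesum : ∀ n, e₀ n + e₁ n = e n := by
    intro n
    have := Finset.card_filter_add_card_filter_not
      (s := (Finset.Icc (-(n : ℤ)) n).filter Even) (fun x => Even (x / (w : ℤ)))
    simp only [Int.not_even_iff_odd, Finset.filter_filter] at this
    exact this
  have lin : ∀ n, ((o n : ℝ) ≤ e n + 1 ∧ (e n : ℝ) ≤ o n + 1) ∧
      ((e₀ n : ℝ) ≤ e₁ n + w ∧ (e₁ n : ℝ) ≤ e₀ n + w) ∧
      ((o n : ℝ) + e n = 2 * n + 1 ∧ (e₀ n : ℝ) + e₁ n = e n) := fun n =>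
    ⟨⟨by exact_mod_cast hoe n, by exact_mod_cast heo n⟩,
      ⟨by exact_mod_cast h01 n, by exact_mod_cast h10 n⟩,
      ⟨by exact_mod_cast hsum n, by exact_mod_cast hesum n⟩⟩
  have ho := tendsto_div_of_bounded_error (f := o) (c := 1 / 2) (K := 1) fun n => by
    obtain ⟨⟨_, _⟩, ⟨_, _⟩, _, _⟩ := lin n
    rw [abs_le]; constructor <;> linarith
  have he₀ := tendsto_div_of_bounded_error (f := e₀) (c := 1 / 4) (K := w + 1) fun n => by
    obtain ⟨⟨_, _⟩, ⟨_, _⟩, _, _⟩ := lin n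
    rw [abs_le]; constructor <;> linarith
  have he₁ := tendsto_div_of_bounded_error (f := e₁) (c := 1 / 4) (K := w + 1) fun n => by
    obtain ⟨⟨_, _⟩, ⟨_, _⟩, _, _⟩ := lin n
    rw [abs_le]; constructor <;> linarith
  have hlim := (ho.mul ho).add ((he₀.mul he₁).const_mul 2)
  rw [show (1 / 2 * (1 / 2) + 2 * (1 / 4 * (1 / 4)) : ℝ) = 3 / 8 by norm_num] at hlim
  refine Tendsto.limsup_eq (hlim.congr fun n => ?_)
  rw [card_checkerCode_inter_Qset]
  push_cast
  have hpos : (2 * (n : ℝ) + 1) ≠ 0 := by positivity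
  field_simp
  rfl

lemma exists_of_mem_Spat {r Δ : ℝ} {p : ℤ × ℤ} (hp : p ∈ Spat r Δ (0, 0) (-1, 0)) :
    ∃ a : ℤ, (a = p.1 ∨ a = -1 - p.1) ∧ ((a ^ 2 + p.2 ^ 2 : ℤ) : ℝ) ≤ r ^ 2 ∧
      (r + Δ) ^ 2 < (((a + 1) ^ 2 + p.2 ^ 2 : ℤ) : ℝ) := by
  rcases hp with ⟨h1, h2⟩ | ⟨h1, h2⟩ <;> rw [mem_ball_iff] at h1 h2 <;>
    simp only [sub_zero, sub_neg_eq_add, not_le] at h1 h2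
  · exact ⟨p.1, Or.inl rfl, h1, h2⟩
  · refine ⟨-1 - p.1, Or.inr rfl, ?_, ?_⟩
    · convert h1 using 2; ring
    · rw [show -1 - p.1 + 1 = -p.1 by ring, neg_sq]; exact h2

lemma exists_corner_of_card_eq_four {r Δ : ℝ} (hr : 0 < r) (hΔ : 0 ≤ Δ)
    (h : Nat.card ↥(Spat r Δ ((0, 0) : ℤ × ℤ) ((-1, 0) : ℤ × ℤ)) = 4) :
    ∃ a b : ℤ, 1 ≤ a ∧ 1 ≤ b ∧ ((a ^ 2 + b ^ 2 : ℤ) : ℝ) ≤ r ^ 2 ∧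
      (r + Δ) ^ 2 < (((a + 1) ^ 2 + b ^ 2 : ℤ) : ℝ) := by
  rw [Nat.card_coe_set_eq] at h
  have hfin : (Spat r Δ ((0, 0) : ℤ × ℤ) ((-1, 0) : ℤ × ℤ)).Finite :=
    Set.finite_of_ncard_ne_zero (by lia)
  have hle : r ^ 2 ≤ (r + Δ) ^ 2 := by gcongr; linarith
  have lt_of : ∀ {m M : ℤ}, (m : ℝ) ≤ r ^ 2 → (r + Δ) ^ 2 < (M : ℝ) → m < M := by
    intro m M h1 h2
    exact_mod_cast h1.trans_lt (hle.trans_lt h2)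
  obtain ⟨p, hp, hp2⟩ : ∃ p ∈ Spat r Δ ((0, 0) : ℤ × ℤ) (-1, 0), p.2 ≠ 0 := by
    by_contra! hall
    suffices hsub : Spat r Δ ((0, 0) : ℤ × ℤ) (-1, 0) ⊆
        {((⌊r⌋, 0) : ℤ × ℤ), (-1 - ⌊r⌋, 0)} by
      have := (Set.ncard_le_ncard hsub (by simp)).trans (Set.ncard_insert_le _ _)
      rw [Set.ncard_singleton] at this
      lia
    rintro ⟨x, y⟩ hp
    obtain rfl : y = 0 := hall _ hp
    obtain ⟨a, hax, h1, h2⟩ := exists_of_mem_Spat hp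
    have hlt := lt_of h1 h2
    have hfloor : ⌊r⌋ = a := by
      push_cast at h1 h2
      have ha : (0 : ℝ) ≤ a := by
        have : 0 ≤ a := by nlinarith
        exact_mod_cast this
      rw [Int.floor_eq_iff]
      constructor
      · exact abs_le_of_sq_le_sq' (by linarith) hr.le |>.2
      · exact lt_of_pow_lt_pow_left₀ 2 (by positivity) (by linarith)
    rw [hfloor]
    grind
  obtain ⟨a, -, h1, h2⟩ := exists_of_mem_Spat hp
  rw [← sq_abs p.2] at h1 h2
  have hb : 1 ≤ |p.2| := Int.one_le_abs hp2
  generalize |p.2| = b at h1 h2 hb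
  have ha : 0 ≤ a := by nlinarith [lt_of h1 h2]
  refine ⟨a, b, ?_, hb, h1, h2⟩
  by_contra hlt
  obtain rfl : a = 0 := by lia
  have hmem : ∀ q : ℤ × ℤ,
      Separates (0 ^ 2 + b ^ 2) ((0 + 1) ^ 2 + b ^ 2) (0, 0) (-1, 0) q →
      q ∈ Spat r Δ (0, 0) (-1, 0) := fun q => Separates.mem_Spat h1 h2
  let F : Finset (ℤ × ℤ) := {(0, b), (0, -b), (-1, b), (-1, -b), (b, 0)}
  have hF : (F : Set (ℤ × ℤ)) ⊆ Spat r Δ (0, 0) (-1, 0) := by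
    intro q hq
    apply hmem
    simp only [F, Finset.coe_insert, Finset.coe_singleton, Set.mem_insert_iff,
      Set.mem_singleton_iff] at hq
    simp only [Separates]
    rcases hq with rfl | rfl | rfl | rfl | rfl <;> simp
    nlinarith
  have hcard : F.card = 5 := by
    simp only [F]
    repeat rw [Finset.card_insert_of_notMem (by simp; lia)]
    simp
  have := Set.ncard_le_ncard hF hfin
  rw [Set.ncard_coe_finset] at this
  lia

theorem stmt12 (r Δ : ℝ) (hr : 0 < r) (hΔ : 0 ≤ Δ)
    (h : Nat.card ↥(Spat r Δ ((0, 0) : ℤ × ℤ) ((-1, 0) : ℤ × ℤ)) = 4) :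
    ∃ C : Set (ℤ × ℤ), IsIdCode r Δ C ∧ density C = 3 / 8 := by
  obtain ⟨a, b, ha, hb, h1, h2⟩ := exists_corner_of_card_eq_four hr hΔ h
  obtain ⟨k, m, hm, hkm⟩ := Nat.exists_eq_two_pow_mul_odd (n := b.toNat) (by lia)
  have hw : 0 < 2 * 2 ^ k := by positivity
  refine ⟨checkerCode ((2 * 2 ^ k : ℕ) : ℤ), ⟨fun u => ?_, fun u v huv => ?_⟩,
    density_checkerCode hw (even_two_mul _)⟩
  · have h2r : (2 : ℝ) ≤ r ^ 2 := by
      refine le_trans ?_ h1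
      have : 2 ≤ a ^ 2 + b ^ 2 := by nlinarith
      exact_mod_cast this
    obtain ⟨p, hp, hodd⟩ := exists_odd_mem_ball h2r u
    exact ⟨p, hp, Or.inl hodd⟩
  · have hbm : 2 * b = ((2 * 2 ^ k : ℕ) : ℤ) * (m : ℤ) := by
      have : b = ((2 ^ k * m : ℕ) : ℤ) := by rw [← hkm]; lia
      rw [this]; push_cast; ring
    obtain ⟨p, hp, hS⟩ := exists_checkerCode_separates ha hb (by exact_mod_cast hw) hbm
      (by exact_mod_cast hm) huv
    exact ⟨p, hS.mem_Spat h1 h2, hp⟩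
end

section
/- Let k and i be positive integers such that i is odd and i² < 2k + 1. Let r = √(k² + i²) and Δ = √(r² + 2k) − r. Then S_{r,Δ}((0,0),(−1,0)) = {(k,i), (k,−i), (−k−1,i), (−k−1,−i)}; in particular |S_{r,Δ}((0,0),(−1,0))| = 4, and S_{r,Δ}((0,0),(−1,0)) intersects all diagonal lines modulo 4 (indeed the four values i−k, −i−k, i+k+1, −i+k+1 are pairwise distinct modulo 4). -/
open Filter

theorem mem_ball_iff_le_of_sq_eq {r : ℝ} {n : ℤ} (hr : r ^ 2 = n) (u v : ℤ × ℤ) :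
    v ∈ ball r u ↔ (v.1 - u.1) ^ 2 + (v.2 - u.2) ^ 2 ≤ n := by
  simp only [ball, Set.mem_ofPred_eq, hr]
  norm_cast

theorem sq_add_sq_le_and_lt_iff {k i : ℤ} (hk : 0 ≤ k) (hik : i ^ 2 < 2 * k + 1) (x y : ℤ) :
    (x ^ 2 + y ^ 2 ≤ k ^ 2 + i ^ 2 ∧ k ^ 2 + i ^ 2 + 2 * k < (x + 1) ^ 2 + y ^ 2) ↔
      x = k ∧ (y = i ∨ y = -i) := by
  constructor
  · rintro ⟨h₁, h₂⟩
    have hx : k ≤ x := by linarith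
    have hxk : x = k := by
      by_contra hne
      have : k + 1 ≤ x := by omega
      nlinarith [sq_nonneg y]
    subst hxk
    exact ⟨rfl, sq_eq_sq_iff_eq_or_eq_neg.mp (by linarith)⟩
  · rintro ⟨rfl, rfl | rfl⟩ <;> constructor <;> linarith

theorem Spat_zero_neg_one_eq {k i : ℤ} (hk : 0 ≤ k) (hik : i ^ 2 < 2 * k + 1) {r Δ : ℝ}
    (hr : r ^ 2 = (k ^ 2 + i ^ 2 : ℤ)) (hΔ : (r + Δ) ^ 2 = (k ^ 2 + i ^ 2 + 2 * k : ℤ)) :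
    Spat r Δ (0, 0) (-1, 0) = {(k, i), (k, -i), (-k - 1, i), (-k - 1, -i)} := by
  ext ⟨x, y⟩
  have h₁ := sq_add_sq_le_and_lt_iff hk hik x y
  have h₂ := sq_add_sq_le_and_lt_iff hk hik (-x - 1) y
  rw [show (-x - 1) ^ 2 = (x + 1) ^ 2 by ring, show (-x - 1 + 1) ^ 2 = x ^ 2 by ring] at h₂
  simp only [Spat, Set.mem_union, Set.mem_sdiff, mem_ball_iff_le_of_sq_eq hr,
    mem_ball_iff_le_of_sq_eq hΔ, sub_zero, sub_neg_eq_add, not_le, h₁, h₂,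
    Set.mem_insert_iff, Set.mem_singleton_iff, Prod.mk.injEq]
  omega

theorem intersectsDiagMod_four {k i : ℤ} (hi : Odd i) :
    IntersectsDiagMod {(k, i), (k, -i), (-k - 1, i), (-k - 1, -i)} 4 := by
  intro j
  obtain ⟨m, rfl⟩ := hi
  simp only [Set.mem_insert_iff, Set.mem_singleton_iff, exists_eq_or_imp, exists_eq_left,
    Int.ModEq]
  omega

theorem card_symmetric_four_points {k i : ℤ} (hi : 0 < i) :
    Nat.card ({(k, i), (k, -i), (-k - 1, i), (-k - 1, -i)} : Set (ℤ × ℤ)) = 4 := by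
  have h : ({(k, i), (k, -i), (-k - 1, i), (-k - 1, -i)} : Set (ℤ × ℤ)) =
      ({k, -k - 1} : Set ℤ) ×ˢ ({i, -i} : Set ℤ) := by
    ext ⟨x, y⟩
    simp only [Set.mem_insert_iff, Set.mem_singleton_iff, Set.mem_prod, Prod.mk.injEq]
    tauto
  rw [h, Nat.card_coe_set_eq, Set.ncard_prod, Set.ncard_pair (by omega),
    Set.ncard_pair (by omega)]

theorem stmt13 (k i : ℕ) (hk : 0 < k) (hi : 0 < i) (hodd : Odd i)
    (hik : i ^ 2 < 2 * k + 1) (r Δ : ℝ)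
    (hr : r = Real.sqrt ((k : ℝ) ^ 2 + (i : ℝ) ^ 2))
    (hΔ : r + Δ = Real.sqrt (r ^ 2 + 2 * (k : ℝ))) :
    Spat r Δ ((0, 0) : ℤ × ℤ) ((-1, 0) : ℤ × ℤ) =
        {((k : ℤ), (i : ℤ)), ((k : ℤ), -(i : ℤ)),
          (-(k : ℤ) - 1, (i : ℤ)), (-(k : ℤ) - 1, -(i : ℤ))} ∧
      Nat.card ↥(Spat r Δ ((0, 0) : ℤ × ℤ) ((-1, 0) : ℤ × ℤ)) = 4 ∧
      IntersectsDiagMod (Spat r Δ ((0, 0) : ℤ × ℤ) ((-1, 0) : ℤ × ℤ)) 4 := by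
  have hr' : r ^ 2 = (((k : ℤ) ^ 2 + (i : ℤ) ^ 2 : ℤ) : ℝ) := by
    rw [hr, Real.sq_sqrt (by positivity)]
    push_cast
    rfl
  have hΔ' : (r + Δ) ^ 2 = (((k : ℤ) ^ 2 + (i : ℤ) ^ 2 + 2 * (k : ℤ) : ℤ) : ℝ) := by
    rw [hΔ, Real.sq_sqrt (by positivity), hr']
    push_cast
    rfl
  rw [Spat_zero_neg_one_eq (by positivity) (by exact_mod_cast hik) hr' hΔ']
  exact ⟨rfl, card_symmetric_four_points (by exact_mod_cast hi),
    intersectsDiagMod_four (by exact_mod_cast hodd)⟩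
end

section
/- Let k be an odd positive integer not divisible by 3, let r = 2k² + 1 and Δ = √(r² + 2r − 3) − r. Then S_{r,Δ}((0,0),(−1,0)) = {(r,0), (−r−1,0), (r−1,2k), (r−1,−2k), (−r,2k), (−r,−2k)}; in particular |S_{r,Δ}((0,0),(−1,0))| = 6, and S_{r,Δ}((0,0),(−1,0)) intersects all diagonal lines modulo 6 (the six values −r, r+1, 2k−r+1, −2k−r+1, 2k+r, −2k+r are pairwise distinct modulo 6). -/
open Filter

lemma mem_ball_sdiff_ball_iff {k r a y : ℤ} (hk : 0 < k) (hr : r = 2 * k ^ 2 + 1) :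
    (a ^ 2 + y ^ 2 ≤ r ^ 2 ∧ r ^ 2 + 2 * r - 3 < (a + 1) ^ 2 + y ^ 2) ↔
      (a = r ∧ y = 0) ∨ (a = r - 1 ∧ (y = 2 * k ∨ y = -(2 * k))) := by
  have hr3 : 3 ≤ r := by nlinarith
  constructor
  · rintro ⟨h1, h2⟩
    have ha : r - 1 ≤ a := by
      have : 2 * r - 3 < 2 * a + 1 := by nlinarith
      omega
    have ha' : a ≤ r := by nlinarith [sq_nonneg y]
    obtain rfl | rfl : a = r ∨ a = r - 1 := by omega
    · left
      have : y ^ 2 = 0 := le_antisymm (by linarith) (sq_nonneg y)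
      exact ⟨rfl, by simpa using this⟩
    · right
      refine ⟨rfl, sq_eq_sq_iff_eq_or_eq_neg.mp ?_⟩
      have hlow : 2 * k ≤ |y| := by
        by_contra! h
        nlinarith [abs_nonneg y, sq_abs y]
      have hup : |y| ≤ 2 * k := by
        by_contra! h
        nlinarith [abs_nonneg y, sq_abs y]
      rw [← sq_abs y, le_antisymm hup hlow]
  · rintro (⟨rfl, rfl⟩ | ⟨rfl, rfl | rfl⟩) <;> constructor <;> nlinarith

lemma mem_Spat_iff {k r : ℤ} (hk : 0 < k) (hr : r = 2 * k ^ 2 + 1) {Δ : ℝ}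
    (hΔ : (r : ℝ) + Δ = Real.sqrt ((r : ℝ) ^ 2 + 2 * (r : ℝ) - 3)) (p : ℤ × ℤ) :
    p ∈ Spat (r : ℝ) Δ ((0, 0) : ℤ × ℤ) ((-1, 0) : ℤ × ℤ) ↔
      (p.1 ^ 2 + p.2 ^ 2 ≤ r ^ 2 ∧ r ^ 2 + 2 * r - 3 < (p.1 + 1) ^ 2 + p.2 ^ 2) ∨
      ((p.1 + 1) ^ 2 + p.2 ^ 2 ≤ r ^ 2 ∧ r ^ 2 + 2 * r - 3 < p.1 ^ 2 + p.2 ^ 2) := by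
  have hr3 : 3 ≤ r := by nlinarith
  have hr3' : (3 : ℝ) ≤ r := by exact_mod_cast hr3
  have hsq : ((r : ℝ) + Δ) ^ 2 = (r : ℝ) ^ 2 + 2 * (r : ℝ) - 3 := by
    rw [hΔ, Real.sq_sqrt (by nlinarith)]
  simp only [Spat, ball, Set.mem_union, Set.mem_sdiff, Set.mem_ofPred_eq, hsq, not_le,
    sub_zero, sub_neg_eq_add]
  norm_cast

lemma Spat_eq {k r : ℤ} (hk : 0 < k) (hr : r = 2 * k ^ 2 + 1) {Δ : ℝ}
    (hΔ : (r : ℝ) + Δ = Real.sqrt ((r : ℝ) ^ 2 + 2 * (r : ℝ) - 3)) :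
    Spat (r : ℝ) Δ ((0, 0) : ℤ × ℤ) ((-1, 0) : ℤ × ℤ) =
      {(r, 0), (-r - 1, 0), (r - 1, 2 * k), (r - 1, -(2 * k)), (-r, 2 * k), (-r, -(2 * k))} := by
  ext ⟨x, y⟩
  have hleft := mem_ball_sdiff_ball_iff (a := x) (y := y) hk hr
  have hright := mem_ball_sdiff_ball_iff (a := -x - 1) (y := y) hk hr
  rw [show (-x - 1) ^ 2 = (x + 1) ^ 2 by ring, show (-x - 1 + 1) ^ 2 = x ^ 2 by ring] at hright
  rw [mem_Spat_iff hk hr hΔ, hleft, hright]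
  simp only [Set.mem_insert_iff, Set.mem_singleton_iff, Prod.mk.injEq]
  omega

theorem stmt14 (k : ℕ) (hk0 : 0 < k) (hodd : Odd k) (h3 : ¬(3 ∣ k))
    (r : ℤ) (hr : r = 2 * (k : ℤ) ^ 2 + 1) (Δ : ℝ)
    (hΔ : (r : ℝ) + Δ = Real.sqrt ((r : ℝ) ^ 2 + 2 * (r : ℝ) - 3)) :
    Spat (r : ℝ) Δ ((0, 0) : ℤ × ℤ) ((-1, 0) : ℤ × ℤ) =
        {(r, 0), (-r - 1, 0), (r - 1, 2 * (k : ℤ)), (r - 1, -(2 * (k : ℤ))),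
          (-r, 2 * (k : ℤ)), (-r, -(2 * (k : ℤ)))} ∧
      Nat.card ↥(Spat (r : ℝ) Δ ((0, 0) : ℤ × ℤ) ((-1, 0) : ℤ × ℤ)) = 6 ∧
      IntersectsDiagMod (Spat (r : ℝ) Δ ((0, 0) : ℤ × ℤ) ((-1, 0) : ℤ × ℤ)) 6 := by
  have hk : (0 : ℤ) < k := by exact_mod_cast hk0
  have hr3 : (3 : ℤ) ≤ r := by nlinarith
  rw [Spat_eq hk hr hΔ]
  refine ⟨rfl, ?_, ?_⟩
  · rw [Nat.card_coe_set_eq]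
    have hcoe : ({(r, 0), (-r - 1, 0), (r - 1, 2 * (k : ℤ)), (r - 1, -(2 * (k : ℤ))),
        (-r, 2 * (k : ℤ)), (-r, -(2 * (k : ℤ)))} : Set (ℤ × ℤ)) =
        (({(r, 0), (-r - 1, 0), (r - 1, 2 * (k : ℤ)), (r - 1, -(2 * (k : ℤ))),
          (-r, 2 * (k : ℤ)), (-r, -(2 * (k : ℤ)))} : Finset (ℤ × ℤ)) : Set (ℤ × ℤ)) := by
      simp
    rw [hcoe, Set.ncard_coe_finset]
    repeat rw [Finset.card_insert_of_notMem (by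
      simp only [Finset.mem_insert, Finset.mem_singleton, Prod.mk.injEq]; omega)]
    rw [Finset.card_singleton]
  · have hk6 : (k : ℤ) % 6 = 1 ∨ (k : ℤ) % 6 = 5 := by
      obtain ⟨m, rfl⟩ := hodd
      omega
    have hr6 : r % 6 = 3 := by
      rcases hk6 with h | h <;> simp [hr, pow_two, Int.add_emod, Int.mul_emod, h]
    intro i
    simp only [Set.mem_insert_iff, Set.mem_singleton_iff, exists_eq_or_imp, exists_eq_left,
      Int.ModEq, Nat.cast_ofNat]
    omega
end

section
/- Let k ≥ 18 be an integer with k ≡ 2 (mod 16), let L = (k/2)² − 1, let r = √(L² + 8) and Δ = √(L² + 2L + 4) − r. Then S_{r,Δ}((0,0),(−1,0)) = {(L,2), (L,−2), (L−2,k), (L−2,−k), (−L−1,2), (−L−1,−2), (−L+1,k), (−L+1,−k)}; in particular |S_{r,Δ}((0,0),(−1,0))| = 8, and S_{r,Δ}((0,0),(−1,0)) intersects all diagonal lines modulo 8 (its eight elements lie on pairwise distinct diagonal lines modulo 8). -/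
open Filter

theorem mem_ball_sqrt_iff (n : ℤ) (hn : 0 ≤ n) (u v : ℤ × ℤ) :
    v ∈ ball (Real.sqrt (n : ℝ)) u ↔ (v.1 - u.1) ^ 2 + (v.2 - u.2) ^ 2 ≤ n := by
  have h : (0 : ℝ) ≤ n := by exact_mod_cast hn
  simp only [ball, Set.mem_ofPred_eq, Real.sq_sqrt h]
  exact_mod_cast Iff.rfl

/-- The integer points of one of the two lunes, for a squared inner radius `L ^ 2 + 8`. -/
theorem lune_iff (m L x y : ℤ) (hm : 9 ≤ m) (hmod : m % 8 = 1) (hL : L = m ^ 2 - 1) :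
    (x ^ 2 + y ^ 2 ≤ L ^ 2 + 8 ∧ L ^ 2 + 2 * L + 4 < (x + 1) ^ 2 + y ^ 2) ↔
      (x = L ∧ (y = 2 ∨ y = -2)) ∨ (x = L - 2 ∧ (y = 2 * m ∨ y = -(2 * m))) := by
  have hL80 : 80 ≤ L := by nlinarith
  constructor
  · rintro ⟨h₁, h₂⟩
    have hlow : L - 2 ≤ x := by nlinarith
    have hhigh : x ≤ L := by
      by_contra! h
      nlinarith [sq_nonneg y]
    obtain hx | hx | hx : x = L ∨ x = L - 1 ∨ x = L - 2 := by omega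
    · subst hx
      refine Or.inl ⟨rfl, ?_⟩
      have hy₁ : y ≤ 2 := by nlinarith
      have hy₂ : -2 ≤ y := by nlinarith
      interval_cases y <;> first | omega | (exfalso; nlinarith)
    · exfalso
      subst hx
      obtain ⟨t, rfl⟩ : ∃ t, m = 8 * t + 1 := ⟨m / 8, by omega⟩
      have hy₁ : 8 * (16 * t ^ 2 + 4 * t) + 5 ≤ y ^ 2 := by nlinarith
      have hy₂ : y ^ 2 ≤ 8 * (16 * t ^ 2 + 4 * t) + 7 := by nlinarith
      have hsq : y ^ 2 % 8 = 0 ∨ y ^ 2 % 8 = 1 ∨ y ^ 2 % 8 = 4 := by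
        have : y % 8 = 0 ∨ y % 8 = 1 ∨ y % 8 = 2 ∨ y % 8 = 3 ∨ y % 8 = 4 ∨ y % 8 = 5 ∨
            y % 8 = 6 ∨ y % 8 = 7 := by omega
        rcases this with h | h | h | h | h | h | h | h <;> simp [pow_two, Int.mul_emod, h]
      omega
    · subst hx
      have hsq : y ^ 2 = (2 * m) ^ 2 := by nlinarith
      exact Or.inr ⟨rfl, sq_eq_sq_iff_eq_or_eq_neg.mp hsq⟩
  · rintro (⟨rfl, rfl | rfl⟩ | ⟨rfl, rfl | rfl⟩) <;> constructor <;> nlinarith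

theorem stmt15 (k : ℤ) (hk : 18 ≤ k) (hmod : k % 16 = 2) (L : ℤ)
    (hL : L = (k / 2) ^ 2 - 1) (r Δ : ℝ)
    (hr : r = Real.sqrt ((L : ℝ) ^ 2 + 8))
    (hΔ : r + Δ = Real.sqrt ((L : ℝ) ^ 2 + 2 * (L : ℝ) + 4)) :
    Spat r Δ ((0, 0) : ℤ × ℤ) ((-1, 0) : ℤ × ℤ) =
        {(L, 2), (L, -2), (L - 2, k), (L - 2, -k),
          (-L - 1, 2), (-L - 1, -2), (-L + 1, k), (-L + 1, -k)} ∧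
      Nat.card ↥(Spat r Δ ((0, 0) : ℤ × ℤ) ((-1, 0) : ℤ × ℤ)) = 8 ∧
      IntersectsDiagMod (Spat r Δ ((0, 0) : ℤ × ℤ) ((-1, 0) : ℤ × ℤ)) 8 := by
  obtain ⟨m, rfl⟩ : ∃ m, k = 2 * m := ⟨k / 2, by omega⟩
  have hm : 9 ≤ m := by omega
  have hm8 : m % 8 = 1 := by omega
  rw [Int.mul_ediv_cancel_left m two_ne_zero] at hL
  have hL80 : 80 ≤ L := by nlinarith
  have hL8 : L % 8 = 0 := by
    rw [hL, pow_two, Int.sub_emod, Int.mul_emod, hm8]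
    norm_num
  have hr' : r = Real.sqrt ((L ^ 2 + 8 : ℤ) : ℝ) := by rw [hr]; push_cast; rfl
  have hΔ' : r + Δ = Real.sqrt ((L ^ 2 + 2 * L + 4 : ℤ) : ℝ) := by rw [hΔ]; push_cast; rfl
  have hS : Spat r Δ ((0, 0) : ℤ × ℤ) ((-1, 0) : ℤ × ℤ) =
      {(L, 2), (L, -2), (L - 2, 2 * m), (L - 2, -(2 * m)),
        (-L - 1, 2), (-L - 1, -2), (-L + 1, 2 * m), (-L + 1, -(2 * m))} := by
    ext ⟨x, y⟩
    have h₁ := lune_iff m L x y hm hm8 hL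
    have h₂ := lune_iff m L (-1 - x) y hm hm8 hL
    rw [show (-1 - x) ^ 2 = (x + 1) ^ 2 by ring, show (-1 - x + 1) ^ 2 = x ^ 2 by ring] at h₂
    have hx₁ : -1 - x = L ↔ x = -L - 1 := by omega
    have hx₂ : -1 - x = L - 2 ↔ x = -L + 1 := by omega
    rw [Spat, hΔ', hr']
    simp only [Set.mem_union, Set.mem_sdiff, mem_ball_sqrt_iff _ (by positivity : 0 ≤ L ^ 2 + 8),
      mem_ball_sqrt_iff _ (by positivity : 0 ≤ L ^ 2 + 2 * L + 4), sub_zero, sub_neg_eq_add,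
      not_le, h₁, h₂, Set.mem_insert_iff, Set.mem_singleton_iff, Prod.mk.injEq, hx₁, hx₂,
      and_or_left, or_assoc]
  refine ⟨hS, ?_, ?_⟩
  · rw [hS, Nat.card_coe_set_eq]
    have hcoe : ({(L, 2), (L, -2), (L - 2, 2 * m), (L - 2, -(2 * m)),
        (-L - 1, 2), (-L - 1, -2), (-L + 1, 2 * m), (-L + 1, -(2 * m))} : Set (ℤ × ℤ)) =
        (({(L, 2), (L, -2), (L - 2, 2 * m), (L - 2, -(2 * m)),
        (-L - 1, 2), (-L - 1, -2), (-L + 1, 2 * m), (-L + 1, -(2 * m))} : Finset (ℤ × ℤ)) :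
          Set (ℤ × ℤ)) := by push_cast; rfl
    rw [hcoe, Set.ncard_coe_finset]
    repeat rw [Finset.card_insert_of_notMem (by
      simp only [Finset.mem_insert, Finset.mem_singleton, Prod.mk.injEq]; omega)]
    rw [Finset.card_singleton]
  · intro i
    rw [hS]
    have hi : i % 8 = 0 ∨ i % 8 = 1 ∨ i % 8 = 2 ∨ i % 8 = 3 ∨ i % 8 = 4 ∨ i % 8 = 5 ∨
        i % 8 = 6 ∨ i % 8 = 7 := by omega
    rcases hi with h | h | h | h | h | h | h | h
    · exact ⟨(L - 2, -(2 * m)), by simp, by simp only [Int.ModEq, Nat.cast_ofNat]; omega⟩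
    · exact ⟨(-L + 1, 2 * m), by simp, by simp only [Int.ModEq, Nat.cast_ofNat]; omega⟩
    · exact ⟨(L, 2), by simp, by simp only [Int.ModEq, Nat.cast_ofNat]; omega⟩
    · exact ⟨(-L - 1, 2), by simp, by simp only [Int.ModEq, Nat.cast_ofNat]; omega⟩
    · exact ⟨(L - 2, 2 * m), by simp, by simp only [Int.ModEq, Nat.cast_ofNat]; omega⟩
    · exact ⟨(-L + 1, -(2 * m)), by simp, by simp only [Int.ModEq, Nat.cast_ofNat]; omega⟩
    · exact ⟨(L, -2), by simp, by simp only [Int.ModEq, Nat.cast_ofNat]; omega⟩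
    · exact ⟨(-L - 1, -2), by simp, by simp only [Int.ModEq, Nat.cast_ofNat]; omega⟩
end

section
/- For r = 1 and Δ = √2 − 1, the optimal density of tolerant identifying codes is 1/2: every (1, √2−1)-identifying code C ⊆ ℤ² satisfies D(C) ≥ 1/2, and there exists a (1, √2−1)-identifying code C with D(C) = 1/2; that is, D(1, √2−1) = 1/2. -/
open Filter

theorem mem_ball_one {u p : ℤ × ℤ} :
    p ∈ ball 1 u ↔ (p.1 - u.1) ^ 2 + (p.2 - u.2) ^ 2 ≤ 1 := by
  simp only [ball, Set.mem_ofPred_eq, one_pow]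
  norm_cast

theorem mem_ball_sqrt_two {u p : ℤ × ℤ} :
    p ∈ ball (1 + (Real.sqrt 2 - 1)) u ↔ (p.1 - u.1) ^ 2 + (p.2 - u.2) ^ 2 ≤ 2 := by
  simp only [ball, Set.mem_ofPred_eq, add_sub_cancel, Real.sq_sqrt zero_le_two]
  norm_cast

theorem mem_or_add_three_mem {C : Set (ℤ × ℤ)} (hC : IsIdCode 1 (Real.sqrt 2 - 1) C)
    (p : ℤ × ℤ) : p ∈ C ∨ p + (3, 0) ∈ C := by
  obtain ⟨x, y⟩ := p
  obtain ⟨⟨a, b⟩, h, hab⟩ := hC.2 (x + 1, y) (x + 2, y) (by simp)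
  simp only [Spat, Set.mem_union, Set.mem_sdiff, mem_ball_one, mem_ball_sqrt_two, not_le] at h
  rcases h with ⟨h1, h2⟩ | ⟨h1, h2⟩
  · left
    have ha : a = x := by nlinarith
    subst ha
    have hb : b = y := by nlinarith
    subst hb
    exact hab
  · right
    have ha : a = x + 3 := by nlinarith
    subst ha
    have hb : b = y := by nlinarith
    subst hb
    simpa using hab

theorem Qset_eq (n : ℕ) :
    Qset n = ↑(Finset.Icc (-(n : ℤ)) n ×ˢ Finset.Icc (-(n : ℤ)) n) := by
  ext p
  simp [Qset, abs_le, Prod.le_def]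
  tauto

theorem finite_Qset (n : ℕ) : (Qset n).Finite := by
  rw [Qset_eq]
  exact Finset.finite_toSet _

theorem ncard_Qset (n : ℕ) : (Qset n).ncard = (2 * n + 1) ^ 2 := by
  rw [Qset_eq, Set.ncard_coe_finset, Finset.card_product, Int.card_Icc, sq]
  congr 1 <;> omega

theorem Qset_mono {m n : ℕ} (h : m ≤ n) : Qset m ⊆ Qset n := by
  intro p hp
  simp only [Qset, Set.mem_ofPred_eq] at *
  omega

theorem add_three_mem_Qset {n : ℕ} {p : ℤ × ℤ} (hp : p ∈ Qset n) :
    p + (3, 0) ∈ Qset (n + 3) := by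
  simp only [Qset, Set.mem_ofPred_eq, Prod.fst_add, Prod.snd_add, abs_le] at *
  push_cast
  omega

/-- If one of `p`, `p + (3, 0)` always lies in `C`, then `C` has at least about half of the points
of each box. -/
theorem sq_le_two_mul_ncard {C : Set (ℤ × ℤ)} (hC : ∀ p, p ∈ C ∨ p + (3, 0) ∈ C) (n : ℕ) :
    (2 * n + 1) ^ 2 ≤ 2 * (C ∩ Qset (n + 3)).ncard := by
  have hfin : (C ∩ Qset (n + 3)).Finite := (finite_Qset _).inter_of_right C
  have h1 : (Qset n ∩ C).ncard ≤ (C ∩ Qset (n + 3)).ncard :=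
    Set.ncard_le_ncard (fun p hp => ⟨hp.2, Qset_mono (by omega) hp.1⟩) hfin
  have h2 : (Qset n \ C).ncard ≤ (C ∩ Qset (n + 3)).ncard :=
    Set.ncard_le_ncard_of_injOn (· + (3, 0))
      (fun p hp => ⟨(hC p).resolve_left hp.2, add_three_mem_Qset hp.1⟩)
      (add_left_injective _).injOn hfin
  have h3 := Set.ncard_inter_add_ncard_sdiff_eq_ncard (Qset n) C (finite_Qset n)
  rw [ncard_Qset] at h3
  omega

/-- If `p ∈ C` excludes `p + (3, 0) ∈ C`, then `C` has at most about half of the points of each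
box. -/
theorem two_mul_ncard_le_sq {C : Set (ℤ × ℤ)} (hC : ∀ p ∈ C, p + (3, 0) ∉ C) (n : ℕ) :
    2 * (C ∩ Qset n).ncard ≤ (2 * n + 7) ^ 2 := by
  have h1 : (C ∩ Qset n).ncard ≤ (Qset (n + 3) ∩ C).ncard :=
    Set.ncard_le_ncard (fun p hp => ⟨Qset_mono (by omega) hp.2, hp.1⟩)
      ((finite_Qset _).inter_of_left C)
  have h2 : (C ∩ Qset n).ncard ≤ (Qset (n + 3) \ C).ncard :=
    Set.ncard_le_ncard_of_injOn (· + (3, 0))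
      (fun p hp => ⟨add_three_mem_Qset hp.2, hC p hp.1⟩)
      (add_left_injective _).injOn ((finite_Qset _).sdiff)
  have h3 := Set.ncard_inter_add_ncard_sdiff_eq_ncard (Qset (n + 3)) C (finite_Qset _)
  rw [ncard_Qset, show 2 * (n + 3) + 1 = 2 * n + 7 by ring] at h3
  omega

theorem tendsto_half_sq_ratio (c : ℝ) :
    Tendsto (fun n : ℕ => (2 * (n : ℝ) + c) ^ 2 / 2 / (2 * (n : ℝ) + 1) ^ 2) atTop
      (nhds (1 / 2)) := by
  have h0 : Tendsto (fun n : ℕ => 2 * (n : ℝ) + 1) atTop atTop :=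
    tendsto_atTop_add_const_right _ _
      (tendsto_natCast_atTop_atTop.const_mul_atTop (by norm_num))
  have h1 : Tendsto (fun n : ℕ => (1 + (c - 1) / (2 * (n : ℝ) + 1)) ^ 2 / 2) atTop
      (nhds ((1 + 0) ^ 2 / 2)) :=
    ((((tendsto_const_nhds (x := c - 1)).div_atTop h0).const_add 1).pow 2).div_const 2
  convert h1 using 2
  · field_simp
    ring
  · norm_num

theorem density_term_le_one (C : Set (ℤ × ℤ)) (n : ℕ) :
    (Nat.card ↥(C ∩ Qset n) : ℝ) / ((2 * (n : ℝ) + 1) ^ 2) ≤ 1 := by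
  rw [div_le_one (by positivity), Nat.card_coe_set_eq]
  have h := Set.ncard_le_ncard (Set.inter_subset_right (s := C)) (finite_Qset n)
  rw [ncard_Qset] at h
  exact_mod_cast h

theorem isCobounded_density_terms (C : Set (ℤ × ℤ)) :
    IsCoboundedUnder (· ≤ ·) atTop
      (fun n : ℕ => (Nat.card ↥(C ∩ Qset n) : ℝ) / ((2 * (n : ℝ) + 1) ^ 2)) :=
  (isBoundedUnder_of ⟨0, fun n => by positivity⟩ : IsBoundedUnder (· ≥ ·) _ _).isCoboundedUnder_le

theorem half_le_density {C : Set (ℤ × ℤ)} (hC : ∀ p, p ∈ C ∨ p + (3, 0) ∈ C) :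
    1 / 2 ≤ density C := by
  have ht := tendsto_half_sq_ratio (-5)
  rw [← ht.limsup_eq, density]
  refine limsup_le_limsup ?_ ht.isCoboundedUnder_le
    (isBoundedUnder_of ⟨1, density_term_le_one C⟩)
  filter_upwards [eventually_ge_atTop 3] with m hm
  obtain ⟨n, rfl⟩ := Nat.exists_eq_add_of_le' hm
  rw [Nat.card_coe_set_eq]
  gcongr
  have h : ((2 * n + 1 : ℕ) : ℝ) ^ 2 ≤ 2 * ((C ∩ Qset (n + 3)).ncard : ℝ) :=
    mod_cast sq_le_two_mul_ncard hC n
  push_cast at h ⊢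
  rw [show 2 * ((n : ℝ) + 3) + -5 = 2 * n + 1 by ring]
  linarith

theorem density_le_half {C : Set (ℤ × ℤ)} (hC : ∀ p ∈ C, p + (3, 0) ∉ C) :
    density C ≤ 1 / 2 := by
  have ht := tendsto_half_sq_ratio 7
  rw [← ht.limsup_eq, density]
  refine limsup_le_limsup (Eventually.of_forall fun n => ?_) (isCobounded_density_terms C)
    ht.isBoundedUnder_le
  beta_reduce
  rw [Nat.card_coe_set_eq]
  gcongr
  have h : 2 * ((C ∩ Qset n).ncard : ℝ) ≤ (2 * n + 7) ^ 2 :=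
    mod_cast two_mul_ncard_le_sq hC n
  linarith

/-- The start, modulo `6`, of the blocks of three consecutive codewords in each row. -/
def rowShift : Fin 6 → ZMod 6 := ![3, 5, 3, 0, 2, 0]

/-- Membership in the optimal code, for residues modulo `6`. -/
def IsCodeResidue (x y : ZMod 6) : Prop := ZMod.val (x - rowShift y) < 3

instance (x y : ZMod 6) : Decidable (IsCodeResidue x y) := by
  unfold IsCodeResidue
  infer_instance

/-- A doubly `6`-periodic code in which each row has alternating blocks of three codewords and
three non-codewords. -/
def optimalCode : Set (ℤ × ℤ) := {p | IsCodeResidue p.1 p.2}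

/-- The offsets of the points of a ball of radius `1`. -/
def unitOffsets : List (ℤ × ℤ) := [(0, 0), (1, 0), (-1, 0), (0, 1), (0, -1)]

theorem isCodeResidue_covering (x y : ZMod 6) :
    ∃ e ∈ unitOffsets, IsCodeResidue (x + e.1) (y + e.2) := by
  revert x y
  decide +kernel

theorem isCodeResidue_separating (x y : ZMod 6) :
    ∀ a ∈ Finset.Icc (-2 : ℤ) 2, ∀ b ∈ Finset.Icc (-2 : ℤ) 2, (a, b) ≠ (0, 0) →
      ∃ e ∈ unitOffsets,
        (IsCodeResidue (x + e.1) (y + e.2) ∧ 2 < (e.1 - a) ^ 2 + (e.2 - b) ^ 2) ∨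
        (IsCodeResidue (x + a + e.1) (y + b + e.2) ∧ 2 < (a + e.1) ^ 2 + (b + e.2) ^ 2) := by
  revert x y
  decide +kernel

theorem sq_add_sq_le_one_of_mem_unitOffsets : ∀ e ∈ unitOffsets, e.1 ^ 2 + e.2 ^ 2 ≤ 1 := by
  decide

theorem add_mem_ball_one {e : ℤ × ℤ} (he : e ∈ unitOffsets) (u : ℤ × ℤ) : u + e ∈ ball 1 u := by
  simpa [mem_ball_one] using sq_add_sq_le_one_of_mem_unitOffsets e he

theorem optimalCode_covering (u : ℤ × ℤ) : (ball 1 u ∩ optimalCode).Nonempty := by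
  obtain ⟨e, he, h⟩ := isCodeResidue_covering u.1 u.2
  exact ⟨u + e, add_mem_ball_one he u, by simpa [optimalCode] using h⟩

theorem isIdCode_optimalCode : IsIdCode 1 (Real.sqrt 2 - 1) optimalCode := by
  refine ⟨optimalCode_covering, fun u v huv => ?_⟩
  by_cases hd : v.1 - u.1 ∈ Finset.Icc (-2 : ℤ) 2 ∧ v.2 - u.2 ∈ Finset.Icc (-2 : ℤ) 2
  · have hne : (v.1 - u.1, v.2 - u.2) ≠ (0, 0) := by
      intro h
      simp only [Prod.mk.injEq, sub_eq_zero] at h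
      exact huv (Prod.ext h.1.symm h.2.symm)
    obtain ⟨e, he, ⟨h1, h2⟩ | ⟨h1, h2⟩⟩ :=
      isCodeResidue_separating u.1 u.2 _ hd.1 _ hd.2 hne
    · refine ⟨u + e, Or.inl ⟨add_mem_ball_one he u, ?_⟩, by simpa [optimalCode] using h1⟩
      rw [mem_ball_sqrt_two, not_le]
      simp only [Prod.fst_add, Prod.snd_add]
      linarith
    · refine ⟨v + e, Or.inr ⟨add_mem_ball_one he v, ?_⟩, by simpa [optimalCode] using h1⟩
      rw [mem_ball_sqrt_two, not_le]
      simp only [Prod.fst_add, Prod.snd_add]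
      linarith
  · obtain ⟨p, hp, hpC⟩ := optimalCode_covering u
    refine ⟨p, Or.inl ⟨hp, fun hpv => hd ?_⟩, hpC⟩
    rw [mem_ball_one] at hp
    rw [mem_ball_sqrt_two] at hpv
    simp only [Finset.mem_Icc]
    have h1 : |p.1 - u.1| ≤ 1 := by rw [← sq_le_one_iff_abs_le_one]; nlinarith
    have h2 : |p.2 - u.2| ≤ 1 := by rw [← sq_le_one_iff_abs_le_one]; nlinarith
    have h3 : |p.1 - v.1| < 2 := abs_lt_of_sq_lt_sq (by nlinarith) (by norm_num)
    have h4 : |p.2 - v.2| < 2 := abs_lt_of_sq_lt_sq (by nlinarith) (by norm_num)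
    rw [abs_le] at h1 h2
    rw [abs_lt] at h3 h4
    omega

theorem not_isCodeResidue_add_three (x y : ZMod 6) :
    IsCodeResidue x y → ¬ IsCodeResidue (x + 3) y := by
  revert x y
  decide +kernel

theorem add_three_notMem_optimalCode (p : ℤ × ℤ) (hp : p ∈ optimalCode) :
    p + (3, 0) ∉ optimalCode := by
  simpa [optimalCode] using not_isCodeResidue_add_three p.1 p.2 hp

theorem stmt17 :
    (∀ C : Set (ℤ × ℤ), IsIdCode 1 (Real.sqrt 2 - 1) C → density C ≥ 1 / 2) ∧
      ∃ C : Set (ℤ × ℤ), IsIdCode 1 (Real.sqrt 2 - 1) C ∧ density C = 1 / 2 :=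
  ⟨fun _ hC => half_le_density (mem_or_add_three_mem hC),
    optimalCode, isIdCode_optimalCode,
    le_antisymm (density_le_half add_three_notMem_optimalCode)
      (half_le_density (mem_or_add_three_mem isIdCode_optimalCode))⟩
end
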